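/- There is an absolute constant C such that for every n ≥ 2, every Banach space Y, and every bounded linear operator u from the disc algebra A into Y whose range has dimension at most n, there exists a bounded linear operator û : C(𝕋, ℂ) → Y with û restricted to A equal to u and ‖û‖ ≤ C·(log n)·‖u‖. -/

import Mathlib

open MeasureTheory Real

noncomputable section

instance : Fact (0 < 2 * Real.pi) := ⟨by positivity⟩

/-- The circle group `𝕋`, realized as `ℝ / 2πℤ`, with its normalized Haar measure. -/
abbrev 𝕋 : Type := AddCircle (2 * Real.pi)

lemma fourier_smul_integrable (f : C(𝕋, ℂ)) (n : ℤ) :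
    Integrable (fun t : 𝕋 => fourier (-n) t • f t) AddCircle.haarAddCircle := by
  refine integrableOn_univ.mp ?_
  exact ContinuousOn.integrableOn_compact isCompact_univ
    (Continuous.continuousOn ((fourier (-n)).continuous.smul (map_continuous f)))

/-- The disc algebra: the subspace of `C(𝕋, ℂ)` consisting of continuous functions whose
Fourier coefficients vanish on the negative integers. -/
def discAlgebra : Submodule ℂ C(𝕋, ℂ) where
  carrier := {f | ∀ n : ℤ, n < 0 → fourierCoeff (⇑f) n = 0}
  zero_mem' := by
    intro n _
    simp [fourierCoeff]
  add_mem' := by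
    intro f g hf hg n hn
    have : fourierCoeff (⇑(f + g)) n = fourierCoeff (⇑f) n + fourierCoeff (⇑g) n := by
      simp only [fourierCoeff]
      rw [← integral_add (fourier_smul_integrable f n) (fourier_smul_integrable g n)]
      congr 1
      ext t
      simp only [ContinuousMap.coe_add, Pi.add_apply, smul_eq_mul]
      ring
    rw [this, hf n hn, hg n hn, add_zero]
  smul_mem' := by
    intro c f hf n hn
    have : fourierCoeff (⇑(c • f)) n = c • fourierCoeff (⇑f) n := by
      simp only [fourierCoeff]
      rw [← integral_smul]
      congr 1
      ext t
      simp only [ContinuousMap.coe_smul, Pi.smul_apply, smul_eq_mul]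
      ring
    rw [this, hf n hn, smul_zero]

/-- The normalized Haar measure of the circle. -/
abbrev circleMeasure : Measure 𝕋 := AddCircle.haarAddCircle

lemma Continuous.integrable_circle {E : Type*} [NormedAddCommGroup E] {f : 𝕋 → E}
    (hf : Continuous f) : Integrable f circleMeasure :=
  hf.integrable_of_hasCompactSupport (HasCompactSupport.of_compactSpace f)

lemma integral_circle_mono {f g : 𝕋 → ℝ} (hf : Continuous f) (hg : Continuous g)
    (h : ∀ t, f t ≤ g t) : ∫ t, f t ∂circleMeasure ≤ ∫ t, g t ∂circleMeasure :=
  integral_mono hf.integrable_circle hg.integrable_circle h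

/-- The mean of a continuous function on the circle, as a continuous linear functional. -/
def circleMean : C(𝕋, ℂ) →L[ℂ] ℂ :=
  LinearMap.mkContinuous
    { toFun := fun f => ∫ t, f t ∂circleMeasure
      map_add' := fun f g => integral_add f.continuous.integrable_circle
        g.continuous.integrable_circle
      map_smul' := fun c f => integral_smul c f } 1
    (fun f => by
      have := norm_integral_le_of_norm_le_const (μ := circleMeasure)
        (Filter.Eventually.of_forall f.norm_coe_le_norm)
      simpa using! this)

lemma circleMean_apply (f : C(𝕋, ℂ)) : circleMean f = ∫ t, f t ∂circleMeasure := rfl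

lemma norm_circleMean_le (f : C(𝕋, ℂ)) : ‖circleMean f‖ ≤ ∫ t, ‖f t‖ ∂circleMeasure :=
  norm_integral_le_integral_norm _

lemma fourierCoeff_eq_circleMean (f : C(𝕋, ℂ)) (n : ℤ) :
    fourierCoeff f n = circleMean (fourier (-n) * f) := rfl

lemma fourier_add_eq_mul (m n : ℤ) :
    (fourier (m + n) : C(𝕋, ℂ)) = fourier m * fourier n := by
  ext t; exact fourier_add

lemma star_fourier (n : ℤ) : star (fourier n : C(𝕋, ℂ)) = fourier (-n) := by
  ext t; exact fourier_neg.symm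

lemma fourier_zero_eq_one : (fourier 0 : C(𝕋, ℂ)) = 1 := by
  ext t; exact fourier_zero

lemma circleMean_fourier (n : ℤ) : circleMean (fourier n) = if n = 0 then 1 else 0 := by
  have h : fourierCoeff (fourier n : C(𝕋, ℂ)) 0 = Pi.single (M := fun _ => ℂ) n 1 0 :=
    congrFun (fourierCoeff_fourier n) 0
  rw [fourierCoeff_eq_circleMean, neg_zero, fourier_zero_eq_one, one_mul] at h
  rw [h, Pi.single_apply]
  simp [eq_comm]

lemma mem_discAlgebra_iff {f : C(𝕋, ℂ)} :
    f ∈ discAlgebra ↔ ∀ n : ℤ, n < 0 → circleMean (fourier (-n) * f) = 0 := Iff.rfl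

lemma isClosed_discAlgebra : IsClosed (discAlgebra : Set C(𝕋, ℂ)) := by
  have : (discAlgebra : Set C(𝕋, ℂ)) =
      ⋂ (n : ℤ) (_ : n < 0), {f | circleMean (fourier (-n) * f) = 0} := by
    ext f
    simp [mem_discAlgebra_iff]
  rw [this]
  refine isClosed_iInter fun n => isClosed_iInter fun _ => isClosed_eq ?_ continuous_const
  fun_prop

lemma fourier_mul_mem_discAlgebra {k : ℤ} (hk : 0 ≤ k) {f : C(𝕋, ℂ)} (hf : f ∈ discAlgebra) :
    fourier k * f ∈ discAlgebra := by
  intro n hn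
  have := mem_discAlgebra_iff.1 hf (n - k) (by omega)
  rw [fourierCoeff_eq_circleMean, ← mul_assoc, ← fourier_add_eq_mul]
  rwa [show -(n - k) = -n + k by ring] at this

lemma one_mem_discAlgebra : (1 : C(𝕋, ℂ)) ∈ discAlgebra := by
  rw [← fourier_zero_eq_one, mem_discAlgebra_iff]
  intro n hn
  rw [← fourier_add_eq_mul, circleMean_fourier, if_neg (by omega)]

lemma fourier_mem_discAlgebra {k : ℤ} (hk : 0 ≤ k) : fourier k ∈ discAlgebra := by
  simpa using fourier_mul_mem_discAlgebra hk one_mem_discAlgebra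

/-- The `N`-th Fejér mean of a continuous function on the circle. -/
def fejerMean (N : ℕ) : C(𝕋, ℂ) →ₗ[ℂ] C(𝕋, ℂ) :=
  ((N : ℂ) + 1)⁻¹ • ∑ j ∈ Finset.range (N + 1), ∑ k ∈ Finset.range (N + 1),
    (circleMean.toLinearMap.comp
      (LinearMap.mulLeft ℂ (fourier (-((j : ℤ) - k)) : C(𝕋, ℂ)))).smulRight
        (fourier ((j : ℤ) - k))

lemma fejerMean_apply (N : ℕ) (f : C(𝕋, ℂ)) :
    fejerMean N f = ((N : ℂ) + 1)⁻¹ • ∑ j ∈ Finset.range (N + 1), ∑ k ∈ Finset.range (N + 1),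
      circleMean (fourier (-((j : ℤ) - k)) * f) • fourier ((j : ℤ) - k) := by
  simp [fejerMean, LinearMap.sum_apply]

lemma fejerMean_mem_span {N : ℕ} {f : C(𝕋, ℂ)} (hf : f ∈ discAlgebra) :
    fejerMean N f ∈ Submodule.span ℂ ((fun k : ℤ => (fourier k : C(𝕋, ℂ))) '' {k | 0 ≤ k}) := by
  rw [fejerMean_apply]
  refine Submodule.smul_mem _ _ (Submodule.sum_mem _ fun j _ => Submodule.sum_mem _ fun k _ => ?_)
  by_cases h : (j : ℤ) - k < 0
  · rw [mem_discAlgebra_iff.1 hf _ h, zero_smul]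
    exact Submodule.zero_mem _
  · exact Submodule.smul_mem _ _ (Submodule.subset_span ⟨_, not_lt.1 h, rfl⟩)

lemma fourier_mul_fourier_neg_sub (j k : ℤ) (s t : 𝕋) :
    fourier (-(j - k)) s * fourier (j - k) t =
      fourier j t * (starRingEnd ℂ) (fourier j s) *
        (starRingEnd ℂ) (fourier k t * (starRingEnd ℂ) (fourier k s)) := by
  rw [show -(j - k) = -j + k by ring, sub_eq_add_neg, fourier_add, fourier_add, fourier_neg,
    fourier_neg, map_mul, Complex.conj_conj]
  ring

/-- The Fejér kernel, as a function of two variables. -/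
def fejerKernel (N : ℕ) (t s : 𝕋) : ℝ :=
  ((N : ℝ) + 1)⁻¹ *
    ‖∑ j ∈ Finset.range (N + 1), fourier (j : ℤ) t * (starRingEnd ℂ) (fourier (j : ℤ) s)‖ ^ 2

lemma fejerKernel_nonneg (N : ℕ) (t s : 𝕋) : 0 ≤ fejerKernel N t s := by
  unfold fejerKernel; positivity

lemma continuous_fejerKernel (N : ℕ) (t : 𝕋) : Continuous (fejerKernel N t) := by
  unfold fejerKernel; fun_prop

lemma fejerMean_eq_integral (N : ℕ) (f : C(𝕋, ℂ)) (t : 𝕋) :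
    fejerMean N f t = ∫ s, (fejerKernel N t s : ℂ) * f s ∂circleMeasure := by
  have h : ∀ s, (fejerKernel N t s : ℂ) * f s =
      ((N : ℂ) + 1)⁻¹ * ∑ j ∈ Finset.range (N + 1), ∑ k ∈ Finset.range (N + 1),
        (fourier (-((j : ℤ) - k)) s * f s) * fourier ((j : ℤ) - k) t := by
    intro s
    simp_rw [mul_right_comm _ (f s) _, fourier_mul_fourier_neg_sub]
    simp_rw [← Finset.sum_mul, ← Finset.mul_sum, ← map_sum, ← Finset.sum_mul]
    rw [Complex.mul_conj, Complex.normSq_eq_norm_sq, fejerKernel]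
    push_cast
    ring
  simp_rw [h]
  rw [integral_const_mul, integral_finsetSum _ fun j _ => ?_]
  · rw [fejerMean_apply]
    simp only [ContinuousMap.smul_apply, ContinuousMap.sum_apply, smul_eq_mul]
    congr 1
    refine Finset.sum_congr rfl fun j _ => ?_
    rw [integral_finsetSum _ fun k _ => ?_]
    · refine Finset.sum_congr rfl fun k _ => ?_
      rw [integral_mul_const]; rfl
    · exact Continuous.integrable_circle (by fun_prop)
  · exact Continuous.integrable_circle (by fun_prop)

lemma fejerMean_fourier (N : ℕ) (m : ℤ) :
    fejerMean N (fourier m) = (((Finset.range (N + 1)).filter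
      fun j : ℕ => 0 ≤ (j : ℤ) - m ∧ (j : ℤ) - m ≤ N).card / ((N : ℂ) + 1)) • fourier m := by
  have h : ∀ j : ℕ, ∑ k ∈ Finset.range (N + 1),
      circleMean (fourier (-((j : ℤ) - k)) * fourier m) • (fourier ((j : ℤ) - k) : C(𝕋, ℂ)) =
      if 0 ≤ (j : ℤ) - m ∧ (j : ℤ) - m ≤ N then fourier m else 0 := by
    intro j
    simp_rw [← fourier_add_eq_mul, circleMean_fourier]
    split_ifs with hj
    · rw [Finset.sum_eq_single ((j : ℤ) - m).toNat]
      · rw [if_pos (by omega), one_smul]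
        congr 1; omega
      · intro k _ hk
        rw [if_neg (by omega), zero_smul]
      · intro hk
        exact absurd (Finset.mem_range.2 (by omega)) hk
    · refine Finset.sum_eq_zero fun k hk => ?_
      have := Finset.mem_range.1 hk
      rw [if_neg (by omega), zero_smul]
  rw [fejerMean_apply, Finset.sum_congr rfl fun j _ => h j, ← Finset.sum_filter,
    Finset.sum_const, ← Nat.cast_smul_eq_nsmul ℂ, smul_smul]
  congr 1
  ring

lemma fejerMean_one (N : ℕ) : fejerMean N 1 = 1 := by
  rw [← fourier_zero_eq_one, fejerMean_fourier, Finset.filter_true_of_mem, Finset.card_range]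
  · push_cast
    rw [div_self (by exact_mod_cast Nat.succ_ne_zero N), one_smul]
  · intro j hj
    have := Finset.mem_range.1 hj
    omega

lemma norm_fejerMean_le (N : ℕ) (f : C(𝕋, ℂ)) : ‖fejerMean N f‖ ≤ ‖f‖ := by
  rw [ContinuousMap.norm_le _ (norm_nonneg _)]
  intro t
  have h1 : ∫ s, fejerKernel N t s ∂circleMeasure = 1 := by
    have := fejerMean_eq_integral N 1 t
    simp only [fejerMean_one, ContinuousMap.one_apply, mul_one] at this
    rw [integral_complex_ofReal] at this
    exact_mod_cast this.symm
  have hK := continuous_fejerKernel N t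
  calc ‖fejerMean N f t‖ ≤ ∫ s, ‖(fejerKernel N t s : ℂ) * f s‖ ∂circleMeasure := by
        rw [fejerMean_eq_integral]; exact norm_integral_le_integral_norm _
    _ ≤ ∫ s, fejerKernel N t s * ‖f‖ ∂circleMeasure := by
        refine integral_circle_mono (by fun_prop) (by fun_prop) fun s => ?_
        rw [norm_mul, Complex.norm_real, Real.norm_of_nonneg (fejerKernel_nonneg N t s)]
        exact mul_le_mul_of_nonneg_left (f.norm_coe_le_norm s) (fejerKernel_nonneg N t s)
    _ = ‖f‖ := by rw [integral_mul_const, h1, one_mul]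

lemma tendsto_fejerMean_fourier (m : ℤ) :
    Filter.Tendsto (fun N => fejerMean N (fourier m)) Filter.atTop (nhds (fourier m)) := by
  have key : ∀ N : ℕ, ‖fejerMean N (fourier m) - fourier m‖ ≤ (m.natAbs : ℝ) / ((N : ℝ) + 1) := by
    intro N
    set S := (Finset.range (N + 1)).filter
      fun j : ℕ => 0 ≤ (j : ℤ) - m ∧ (j : ℤ) - m ≤ N with hS
    have hle : S.card ≤ N + 1 := by
      simpa using Finset.card_filter_le (Finset.range (N + 1)) _
    have hge : N + 1 ≤ S.card + m.natAbs := by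
      have hsub : Finset.Icc (max m 0) (min (N : ℤ) (N + m)) ⊆ S.image (fun j : ℕ => (j : ℤ)) := by
        intro x hx
        rw [Finset.mem_Icc] at hx
        refine Finset.mem_image.2 ⟨x.toNat, ?_, by omega⟩
        rw [hS, Finset.mem_filter, Finset.mem_range]
        omega
      have := (Finset.card_le_card hsub).trans Finset.card_image_le
      rw [Int.card_Icc] at this
      omega
    have hN : (0 : ℝ) < (N : ℝ) + 1 := by positivity
    have : fejerMean N (fourier m) - fourier m =
        (((S.card : ℝ) - (N + 1)) / ((N : ℝ) + 1) : ℝ) • (fourier m : C(𝕋, ℂ)) := by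
      rw [fejerMean_fourier, ← hS]
      ext t
      have hN' : (N : ℂ) + 1 ≠ 0 := by exact_mod_cast Nat.succ_ne_zero N
      simp only [ContinuousMap.sub_apply, ContinuousMap.smul_apply, smul_eq_mul,
        Complex.real_smul]
      push_cast
      field_simp
    rw [this, norm_smul, fourier_norm, mul_one, norm_div, Real.norm_of_nonneg hN.le]
    gcongr
    rw [Real.norm_eq_abs, abs_le]
    have h1 : (S.card : ℝ) ≤ N + 1 := by exact_mod_cast hle
    have h2 : (N : ℝ) + 1 ≤ S.card + m.natAbs := by exact_mod_cast hge
    constructor <;> linarith [Nat.cast_nonneg (α := ℝ) m.natAbs]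
  rw [tendsto_iff_norm_sub_tendsto_zero]
  refine squeeze_zero (fun N => norm_nonneg _) key ?_
  exact Filter.Tendsto.div_atTop tendsto_const_nhds
    (Filter.tendsto_atTop_add_const_right _ _ tendsto_natCast_atTop_atTop)

lemma tendsto_fejerMean (f : C(𝕋, ℂ)) :
    Filter.Tendsto (fun N => fejerMean N f) Filter.atTop (nhds f) := by
  have hspan : ∀ p ∈ Submodule.span ℂ (Set.range (fourier : ℤ → C(𝕋, ℂ))),
      Filter.Tendsto (fun N => fejerMean N p) Filter.atTop (nhds p) := by
    intro p hp
    induction hp using Submodule.span_induction with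
    | mem x hx => obtain ⟨m, rfl⟩ := hx; exact tendsto_fejerMean_fourier m
    | zero => simp
    | add x y _ _ hx hy => simpa using hx.add hy
    | smul c x _ hx => simpa using hx.const_smul c
  rw [Metric.tendsto_atTop]
  intro ε hε
  have hf : f ∈ closure (Submodule.span ℂ (Set.range (fourier : ℤ → C(𝕋, ℂ))) : Set C(𝕋, ℂ)) := by
    have := span_fourier_closure_eq_top (T := 2 * π)
    rw [← Submodule.topologicalClosure_coe, this]
    trivial
  obtain ⟨p, hp, hfp⟩ := Metric.mem_closure_iff.1 hf (ε / 3) (by positivity)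
  obtain ⟨N₀, hN₀⟩ := Metric.tendsto_atTop.1 (hspan p hp) (ε / 3) (by positivity)
  refine ⟨N₀, fun N hN => ?_⟩
  have h1 : dist (fejerMean N f) (fejerMean N p) ≤ dist f p := by
    rw [dist_eq_norm, dist_eq_norm, ← map_sub]
    exact norm_fejerMean_le N _
  have h2 := hN₀ N hN
  have h3 := dist_triangle4 (fejerMean N f) (fejerMean N p) p f
  rw [dist_comm p f] at h3
  linarith

lemma fejerMean_mem_discAlgebra {N : ℕ} {f : C(𝕋, ℂ)} (hf : f ∈ discAlgebra) :
    fejerMean N f ∈ discAlgebra := by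
  refine Submodule.span_le.2 ?_ (fejerMean_mem_span hf)
  rintro _ ⟨k, hk, rfl⟩
  exact fourier_mem_discAlgebra hk

/-- A closed subspace containing the monomials of nonnegative degree contains the disc algebra. -/
lemma discAlgebra_le_of_isClosed {V : Submodule ℂ C(𝕋, ℂ)} (hV : IsClosed (V : Set C(𝕋, ℂ)))
    (h : ∀ k : ℤ, 0 ≤ k → fourier k ∈ V) : discAlgebra ≤ V := by
  intro f hf
  refine hV.mem_of_tendsto (tendsto_fejerMean f) (Filter.Eventually.of_forall fun N => ?_)
  refine Submodule.span_le.2 ?_ (fejerMean_mem_span hf)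
  rintro _ ⟨k, hk, rfl⟩
  exact h k hk

lemma mul_mem_discAlgebra {a b : C(𝕋, ℂ)} (ha : a ∈ discAlgebra) (hb : b ∈ discAlgebra) :
    a * b ∈ discAlgebra := by
  let V : Submodule ℂ C(𝕋, ℂ) := discAlgebra.comap (LinearMap.mulRight ℂ b)
  have hV : IsClosed (V : Set C(𝕋, ℂ)) :=
    isClosed_discAlgebra.preimage (f := fun a => a * b) (by fun_prop)
  exact discAlgebra_le_of_isClosed hV (fun k hk => fourier_mul_mem_discAlgebra hk hb) ha

lemma circleMean_mul {a b : C(𝕋, ℂ)} (ha : a ∈ discAlgebra) (hb : b ∈ discAlgebra) :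
    circleMean (a * b) = circleMean a * circleMean b := by
  let φ : C(𝕋, ℂ) →L[ℂ] ℂ := circleMean.comp (ContinuousLinearMap.mul ℂ C(𝕋, ℂ) b) -
    circleMean b • circleMean
  have hφ : ∀ x, φ x = circleMean (b * x) - circleMean b * circleMean x := fun x => rfl
  have hV : IsClosed (LinearMap.ker φ.toLinearMap : Set C(𝕋, ℂ)) := φ.isClosed_ker
  have := discAlgebra_le_of_isClosed hV (fun k hk => ?_) ha
  · have h : φ a = 0 := this
    rw [hφ, sub_eq_zero] at h
    rw [mul_comm a b, h, mul_comm (circleMean b)]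
  · change φ (fourier k) = 0
    rw [hφ, circleMean_fourier, mul_comm b]
    rcases hk.eq_or_lt with rfl | hk
    · simp [fourier_zero_eq_one]
    · rw [if_neg hk.ne', mul_zero, sub_zero]
      simpa using mem_discAlgebra_iff.1 hb (-k) (by omega)

lemma pow_mem_discAlgebra {a : C(𝕋, ℂ)} (ha : a ∈ discAlgebra) (n : ℕ) :
    a ^ n ∈ discAlgebra := by
  induction n with
  | zero => simpa using one_mem_discAlgebra
  | succ n ih => rw [pow_succ]; exact mul_mem_discAlgebra ih ha

/-- The sum of a power series with coefficients `c n` of norm at most `1` at an element of norm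
less than `1` of the disc algebra again belongs to the disc algebra. -/
lemma mem_discAlgebra_of_hasSum {x y : C(𝕋, ℂ)} (hx : x ∈ discAlgebra) (c : ℕ → ℂ)
    (hs : Summable fun n => c n • x ^ n) (hy : ∀ t, HasSum (fun n => c n * x t ^ n) (y t)) :
    y ∈ discAlgebra := by
  have h : HasSum (fun n => c n • x ^ n) y := by
    obtain ⟨z, hz⟩ := hs
    have : z = y := by
      ext t
      have h1 := hz.mapL (ContinuousMap.evalCLM ℂ t)
      exact h1.unique (hy t)
    rwa [← this]
  refine isClosed_discAlgebra.mem_of_tendsto h (Filter.Eventually.of_forall fun s => ?_)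
  exact Submodule.sum_mem _ fun n _ => Submodule.smul_mem _ _ (pow_mem_discAlgebra hx n)

/-- The pointwise exponential of a continuous function. -/
def expMap (f : C(𝕋, ℂ)) : C(𝕋, ℂ) := ⟨fun t => Complex.exp (f t), by fun_prop⟩

lemma expMap_apply (f : C(𝕋, ℂ)) (t : 𝕋) : expMap f t = Complex.exp (f t) := rfl

lemma expMap_mem_discAlgebra {f : C(𝕋, ℂ)} (hf : f ∈ discAlgebra) :
    expMap f ∈ discAlgebra := by
  refine mem_discAlgebra_of_hasSum hf (fun n => ((n.factorial : ℂ))⁻¹)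
    (NormedSpace.expSeries_summable' (𝕂 := ℂ) f) fun t => ?_
  have := NormedSpace.exp_series_hasSum_exp' (𝕂 := ℂ) (f t)
  rw [← Complex.exp_eq_exp_ℂ] at this
  simpa using! this

lemma exists_log_mem_discAlgebra {f : C(𝕋, ℂ)} (hf : f ∈ discAlgebra)
    (hpos : ∀ t, 0 < (f t).re) :
    ∃ L ∈ discAlgebra, ∀ t, L t = Complex.log (f t) := by
  obtain ⟨t₀, -, ht₀⟩ := isCompact_univ.exists_isMinOn (f := fun t : 𝕋 => (f t).re)
    Set.univ_nonempty (by fun_prop)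
  have hmin : ∀ t, (f t₀).re ≤ (f t).re := fun t => ht₀ (Set.mem_univ t)
  set c := (f t₀).re with hc
  have hc0 : 0 < c := hpos t₀
  have hcB : c ≤ ‖f‖ := (Complex.re_le_norm _).trans (f.norm_coe_le_norm t₀)
  have hB0 : 0 < ‖f‖ := hc0.trans_le hcB
  set R : ℝ := ‖f‖ ^ 2 / c with hR
  have hR0 : 0 < R := by positivity
  let L : C(𝕋, ℂ) := ⟨fun t => Complex.log (f t),
    f.continuous.clog fun t => Or.inl (hpos t)⟩
  let x : C(𝕋, ℂ) := 1 - (R : ℂ)⁻¹ • f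
  have hxA : x ∈ discAlgebra :=
    Submodule.sub_mem _ one_mem_discAlgebra (Submodule.smul_mem _ _ hf)
  have hxt : ∀ t, x t = 1 - (R : ℂ)⁻¹ * f t := fun t => rfl
  have hx1 : ∀ t, ‖x t‖ < 1 := by
    intro t
    have h1 : ‖f t‖ ≤ ‖f‖ := f.norm_coe_le_norm t
    have h2 : (f t).re ^ 2 + (f t).im ^ 2 = ‖f t‖ ^ 2 := by
      rw [← Complex.normSq_eq_norm_sq, Complex.normSq_apply]; ring
    have h3 : ‖x t‖ ^ 2 = 1 - 2 * (R⁻¹ * (f t).re) + R⁻¹ ^ 2 * ‖f t‖ ^ 2 := by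
      rw [← h2, ← Complex.normSq_eq_norm_sq, Complex.normSq_apply, hxt, ← Complex.ofReal_inv]
      simp
      ring
    have h4 : ‖x t‖ ^ 2 < 1 := by
      have h5 : R⁻¹ * c ≤ R⁻¹ * (f t).re := by gcongr; exact hmin t
      have h6 : R⁻¹ ^ 2 * ‖f t‖ ^ 2 ≤ R⁻¹ * c := by
        calc R⁻¹ ^ 2 * ‖f t‖ ^ 2 ≤ R⁻¹ ^ 2 * ‖f‖ ^ 2 := by gcongr
          _ = R⁻¹ * c := by rw [hR]; field_simp
      have h7 : 0 < R⁻¹ * c := by positivity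
      linarith
    nlinarith [norm_nonneg (x t)]
  have hx : ‖x‖ < 1 := (ContinuousMap.norm_lt_iff _ one_pos).2 hx1
  have hmem : (Complex.log R) • (1 : C(𝕋, ℂ)) - L ∈ discAlgebra := by
    refine mem_discAlgebra_of_hasSum hxA (fun n => (n : ℂ)⁻¹) ?_ fun t => ?_
    · refine Summable.of_norm_bounded (summable_geometric_of_lt_one (norm_nonneg x) hx)
        fun n => ?_
      rw [norm_smul, norm_inv, Complex.norm_natCast]
      calc (n : ℝ)⁻¹ * ‖x ^ n‖ ≤ 1 * ‖x‖ ^ n := by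
            gcongr
            · exact Nat.cast_inv_le_one n
            · exact norm_pow_le x n
        _ = ‖x‖ ^ n := one_mul _
    · have h := Complex.hasSum_taylorSeries_neg_log (hx1 t)
      have hval : ((Complex.log R) • (1 : C(𝕋, ℂ)) - L) t = -Complex.log (1 - x t) := by
        have h1 : 1 - x t = ((R⁻¹ : ℝ) : ℂ) * f t := by rw [hxt]; push_cast; ring
        have h2 : f t ≠ 0 := fun h => by simpa [h] using hpos t
        rw [h1, Complex.log_ofReal_mul (by positivity) h2, Real.log_inv]
        simp only [ContinuousMap.sub_apply, ContinuousMap.smul_apply, ContinuousMap.one_apply,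
          smul_eq_mul, mul_one, L, ContinuousMap.coe_mk]
        rw [Complex.ofReal_neg, Complex.ofReal_log hR0.le]
        ring
      rw [hval]
      simpa [div_eq_inv_mul] using h
  refine ⟨L, ?_, fun t => rfl⟩
  have := Submodule.sub_mem _ (Submodule.smul_mem _ (Complex.log R) one_mem_discAlgebra) hmem
  simpa using this

lemma inv_mem_discAlgebra {f g : C(𝕋, ℂ)} (hf : f ∈ discAlgebra) (hpos : ∀ t, 0 < (f t).re)
    (hg : ∀ t, g t = (f t)⁻¹) : g ∈ discAlgebra := by
  obtain ⟨L, hL, hLf⟩ := exists_log_mem_discAlgebra hf hpos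
  have : g = expMap (-L) := by
    ext t
    have h2 : f t ≠ 0 := fun h => by simpa [h] using hpos t
    rw [hg, expMap_apply, ContinuousMap.neg_apply, Complex.exp_neg, hLf, Complex.exp_log h2]
  rw [this]
  exact expMap_mem_discAlgebra (Submodule.neg_mem _ hL)

/-- The sums of an element of the disc algebra and of the conjugate of an element of mean zero
of the disc algebra are dense. -/
lemma exists_add_star_norm_sub_lt (f : C(𝕋, ℂ)) {ε : ℝ} (hε : 0 < ε) :
    ∃ a ∈ discAlgebra, ∃ b ∈ discAlgebra, circleMean b = 0 ∧ ‖a + star b - f‖ < ε := by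
  have hspan : ∀ p ∈ Submodule.span ℂ (Set.range (fourier : ℤ → C(𝕋, ℂ))),
      ∃ a ∈ discAlgebra, ∃ b ∈ discAlgebra, circleMean b = 0 ∧ a + star b = p := by
    intro p hp
    induction hp using Submodule.span_induction with
    | mem x hx =>
      obtain ⟨m, rfl⟩ := hx
      rcases le_or_gt 0 m with hm | hm
      · exact ⟨_, fourier_mem_discAlgebra hm, 0, Submodule.zero_mem _, map_zero _, by simp⟩
      · refine ⟨0, Submodule.zero_mem _, fourier (-m), fourier_mem_discAlgebra (by omega), ?_, ?_⟩
        · rw [circleMean_fourier, if_neg (by omega)]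
        · rw [star_fourier, neg_neg, zero_add]
    | zero => exact ⟨0, Submodule.zero_mem _, 0, Submodule.zero_mem _, map_zero _, by simp⟩
    | add x y _ _ hx hy =>
      obtain ⟨a, ha, b, hb, hb0, rfl⟩ := hx
      obtain ⟨a', ha', b', hb', hb0', rfl⟩ := hy
      refine ⟨a + a', Submodule.add_mem _ ha ha', b + b', Submodule.add_mem _ hb hb', ?_, ?_⟩
      · rw [map_add, hb0, hb0', add_zero]
      · rw [star_add]; abel
    | smul c x _ hx =>
      obtain ⟨a, ha, b, hb, hb0, rfl⟩ := hx
      refine ⟨c • a, Submodule.smul_mem _ _ ha, star c • b, Submodule.smul_mem _ _ hb, ?_, ?_⟩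
      · rw [map_smul, hb0, smul_zero]
      · rw [star_smul, star_star, smul_add]
  have hf : f ∈ closure (Submodule.span ℂ (Set.range (fourier : ℤ → C(𝕋, ℂ))) : Set C(𝕋, ℂ)) := by
    have := span_fourier_closure_eq_top (T := 2 * π)
    rw [← Submodule.topologicalClosure_coe, this]
    trivial
  obtain ⟨p, hp, hfp⟩ := Metric.mem_closure_iff.1 hf ε hε
  obtain ⟨a, ha, b, hb, hb0, rfl⟩ := hspan p hp
  exact ⟨a, ha, b, hb, hb0, by rwa [dist_comm, dist_eq_norm] at hfp⟩

/-- For an element of the disc algebra whose mean is real, the `L²` norm is controlled by that of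
its real part. -/
lemma integral_norm_sq_le_two_mul {f : C(𝕋, ℂ)} (hf : f ∈ discAlgebra)
    (him : (circleMean f).im = 0) :
    ∫ t, ‖f t‖ ^ 2 ∂circleMeasure ≤ 2 * ∫ t, (f t).re ^ 2 ∂circleMeasure := by
  have h1 : 0 ≤ (circleMean (f * f)).re := by
    rw [circleMean_mul hf hf, Complex.mul_re, him]
    nlinarith [sq_nonneg (circleMean f).re]
  have h2 : (circleMean (f * f)).re = ∫ t, ((f t).re ^ 2 - (f t).im ^ 2) ∂circleMeasure := by
    rw [circleMean_apply, ← RCLike.re_eq_complex_re,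
      ← integral_re (f * f).continuous.integrable_circle]
    refine integral_congr_ae (Filter.Eventually.of_forall fun t => ?_)
    simp [pow_two]
  have h3 : ∀ t, ‖f t‖ ^ 2 = 2 * (f t).re ^ 2 - ((f t).re ^ 2 - (f t).im ^ 2) := by
    intro t
    rw [← Complex.normSq_eq_norm_sq, Complex.normSq_apply]; ring
  simp_rw [h3]
  rw [integral_sub (Continuous.integrable_circle (by fun_prop))
    (Continuous.integrable_circle (by fun_prop)), ← h2, integral_const_mul]
  linarith

/-- A continuous real function is, up to `ε`, the real part of an element of the disc algebra,
with control of its `L²` norm. -/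
lemma exists_mem_discAlgebra_re_approx {ρ : 𝕋 → ℝ} (hρ : Continuous ρ) {ε : ℝ} (hε : 0 < ε) :
    ∃ R ∈ discAlgebra, (∀ t, ρ t < (R t).re ∧ (R t).re < ρ t + ε) ∧
      ∫ t, ‖R t‖ ^ 2 ∂circleMeasure ≤ 2 * ∫ t, (R t).re ^ 2 ∂circleMeasure := by
  let f : C(𝕋, ℂ) := ⟨fun t => ((ρ t + ε / 2 : ℝ) : ℂ), by fun_prop⟩
  obtain ⟨a, ha, b, hb, -, hab⟩ := exists_add_star_norm_sub_lt f (half_pos hε)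
  have hA : a + b ∈ discAlgebra := Submodule.add_mem _ ha hb
  set c : ℂ := ((circleMean (a + b)).im : ℂ) * Complex.I with hc
  have hR : a + b - c • 1 ∈ discAlgebra :=
    Submodule.sub_mem _ hA (Submodule.smul_mem _ _ one_mem_discAlgebra)
  refine ⟨a + b - c • 1, hR, fun t => ?_, integral_norm_sq_le_two_mul hR ?_⟩
  · have h1 := (Complex.abs_re_le_norm _).trans_lt
      (((a + star b - f).norm_coe_le_norm t).trans_lt hab)
    have h2 : ((a + b - c • 1 : C(𝕋, ℂ)) t).re = (a t).re + (b t).re := by simp [hc]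
    have h3 : ((a + star b - f) t).re = (a t).re + (b t).re - (ρ t + ε / 2) := by simp [f]
    rw [h3, abs_lt] at h1
    rw [h2]
    constructor <;> linarith
  · have : circleMean (1 : C(𝕋, ℂ)) = 1 := by
      rw [← fourier_zero_eq_one, circleMean_fourier, if_pos rfl]
    rw [map_sub, map_smul, this]
    simp [hc]

/-- Minkowski's inequality for continuous functions on the circle. -/
lemma integral_add_pow_le {f g : 𝕋 → ℝ} (hf : Continuous f) (hg : Continuous g)
    (hf0 : ∀ t, 0 ≤ f t) (hg0 : ∀ t, 0 ≤ g t) {x y : ℝ} (hx : 0 < x) (hy : 0 < y) {q : ℕ}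
    (hfx : ∫ t, f t ^ q ∂circleMeasure ≤ x ^ q) (hgy : ∫ t, g t ^ q ∂circleMeasure ≤ y ^ q) :
    ∫ t, (f t + g t) ^ q ∂circleMeasure ≤ (x + y) ^ q := by
  have hxy : 0 < x + y := by positivity
  set A := (x + y) ^ q * (x / (x + y)) / x ^ q with hA
  set B := (x + y) ^ q * (y / (x + y)) / y ^ q with hB
  have hA0 : 0 ≤ A := by positivity
  have hB0 : 0 ≤ B := by positivity
  have hpt : ∀ t, (f t + g t) ^ q ≤ A * f t ^ q + B * g t ^ q := by
    intro t
    have h := (convexOn_pow (𝕜 := ℝ) q).2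
      (show f t / x ∈ Set.Ici (0 : ℝ) from div_nonneg (hf0 t) hx.le)
      (show g t / y ∈ Set.Ici (0 : ℝ) from div_nonneg (hg0 t) hy.le)
      (show 0 ≤ x / (x + y) by positivity) (show 0 ≤ y / (x + y) by positivity)
      (show x / (x + y) + y / (x + y) = 1 by field_simp)
    simp only [smul_eq_mul] at h
    have h1 : x / (x + y) * (f t / x) + y / (x + y) * (g t / y) = (f t + g t) / (x + y) := by
      field_simp
    rw [h1, div_pow, div_le_iff₀ (by positivity), div_pow, div_pow] at h
    calc (f t + g t) ^ q ≤ _ := h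
      _ = A * f t ^ q + B * g t ^ q := by rw [hA, hB]; ring
  calc ∫ t, (f t + g t) ^ q ∂circleMeasure
      ≤ ∫ t, (A * f t ^ q + B * g t ^ q) ∂circleMeasure :=
        integral_circle_mono (by fun_prop) (by fun_prop) hpt
    _ = A * ∫ t, f t ^ q ∂circleMeasure + B * ∫ t, g t ^ q ∂circleMeasure := by
        rw [integral_add (Continuous.integrable_circle (by fun_prop))
          (Continuous.integrable_circle (by fun_prop)), integral_const_mul, integral_const_mul]
    _ ≤ A * x ^ q + B * y ^ q := by gcongr
    _ = (x + y) ^ q := by rw [hA, hB]; field_simp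

/-- The Cauchy–Schwarz inequality for continuous functions on the circle. -/
lemma integral_mul_le_of_sq {f g : 𝕋 → ℝ} (hf : Continuous f) (hg : Continuous g)
    {x y : ℝ} (hx : 0 < x) (hy : 0 < y)
    (hfx : ∫ t, f t ^ 2 ∂circleMeasure ≤ x ^ 2) (hgy : ∫ t, g t ^ 2 ∂circleMeasure ≤ y ^ 2) :
    ∫ t, f t * g t ∂circleMeasure ≤ x * y := by
  have hpt : ∀ t, f t * g t ≤ y / (2 * x) * f t ^ 2 + x / (2 * y) * g t ^ 2 := by
    intro t
    have h : y / (2 * x) * f t ^ 2 + x / (2 * y) * g t ^ 2 - f t * g t =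
        (y * f t - x * g t) ^ 2 / (2 * x * y) := by field_simp; ring
    have : 0 ≤ (y * f t - x * g t) ^ 2 / (2 * x * y) := by positivity
    linarith
  calc ∫ t, f t * g t ∂circleMeasure
      ≤ ∫ t, (y / (2 * x) * f t ^ 2 + x / (2 * y) * g t ^ 2) ∂circleMeasure :=
        integral_circle_mono (by fun_prop) (by fun_prop) hpt
    _ = y / (2 * x) * ∫ t, f t ^ 2 ∂circleMeasure + x / (2 * y) * ∫ t, g t ^ 2 ∂circleMeasure := by
        rw [integral_add (Continuous.integrable_circle (by fun_prop))
          (Continuous.integrable_circle (by fun_prop)), integral_const_mul, integral_const_mul]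
    _ ≤ y / (2 * x) * x ^ 2 + x / (2 * y) * y ^ 2 := by gcongr
    _ = x * y := by field_simp; ring

lemma integral_norm_sq_le_add_star {a b : C(𝕋, ℂ)} (ha : a ∈ discAlgebra) (hb : b ∈ discAlgebra)
    (hb0 : circleMean b = 0) :
    ∫ t, ‖a t‖ ^ 2 ∂circleMeasure ≤ ∫ t, ‖(a + star b) t‖ ^ 2 ∂circleMeasure := by
  have h0 : ∫ t, ((a * b) t).re ∂circleMeasure = 0 := by
    have h := circleMean_mul ha hb
    rw [hb0, mul_zero, circleMean_apply] at h
    have h2 := integral_re (𝕜 := ℂ) (a * b).continuous.integrable_circle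
    simp only [RCLike.re_eq_complex_re] at h2
    rw [h2, h, Complex.zero_re]
  have h1 : ∀ t, ‖a t‖ ^ 2 + 2 * ((a * b) t).re ≤ ‖(a + star b) t‖ ^ 2 := by
    intro t
    simp only [← Complex.normSq_eq_norm_sq, Complex.normSq_apply, ContinuousMap.add_apply,
      ContinuousMap.star_apply, Complex.add_re, Complex.add_im, ContinuousMap.mul_apply,
      Complex.mul_re, RCLike.star_def, Complex.conj_re, Complex.conj_im]
    nlinarith [sq_nonneg (b t).re, sq_nonneg (b t).im]
  calc ∫ t, ‖a t‖ ^ 2 ∂circleMeasure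
      = ∫ t, (‖a t‖ ^ 2 + 2 * ((a * b) t).re) ∂circleMeasure := by
        rw [integral_add (Continuous.integrable_circle (by fun_prop))
          (Continuous.integrable_circle (by fun_prop)), integral_const_mul, h0]
        ring
    _ ≤ _ := integral_circle_mono (by fun_prop) (by fun_prop) h1

/-- The theorem of M. Riesz for the exponents `2 ^ (k + 1)`: the norm on `L^q` of the projection onto
the analytic part is less than `q`. -/
lemma integral_norm_pow_le_of_add_star (k : ℕ) :
    ∀ {a b : C(𝕋, ℂ)}, a ∈ discAlgebra → b ∈ discAlgebra → circleMean b = 0 →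
      ∀ {s : ℝ}, 0 < s →
      ∫ t, ‖(a + star b) t‖ ^ 2 ^ (k + 1) ∂circleMeasure ≤ s ^ 2 ^ (k + 1) →
      ∫ t, ‖a t‖ ^ 2 ^ (k + 1) ∂circleMeasure ≤ ((2 ^ (k + 1) - 1) * s) ^ 2 ^ (k + 1) := by
  induction k with
  | zero =>
    intro a b ha hb hb0 s hs h
    norm_num at h ⊢
    exact (integral_norm_sq_le_add_star ha hb hb0).trans (by simpa using h)
  | succ k ih =>
    intro a b ha hb hb0 s hs h
    set q : ℕ := 2 ^ (k + 1) with hq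
    have hq1 : (2 : ℝ) ≤ q := by
      rw [hq, pow_succ]; push_cast
      linarith [one_le_pow₀ (M₀ := ℝ) one_le_two (n := k)]
    have hq0 : q ≠ 0 := by positivity
    have hqq : 2 ^ (k + 1 + 1) = q * 2 := pow_succ 2 (k + 1)
    have hqq' : (2 : ℝ) ^ (k + 1 + 1) = 2 * q := by rw [hq]; push_cast; ring
    have hqr : (2 : ℝ) ^ (k + 1) = q := by rw [hq]; push_cast; rfl
    rw [hqq] at h ⊢
    rw [hqq']
    rw [hqr] at ih
    set I := ∫ t, ‖a t‖ ^ (q * 2) ∂circleMeasure with hI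
    have hI0 : 0 ≤ I := integral_nonneg fun t => by positivity
    by_contra hcon
    push Not at hcon
    have hJ : 0 < ((2 * q - 1) * s) := mul_pos (by linarith) hs
    have hIpos : 0 < I := (by positivity : (0 : ℝ) < ((2 * q - 1) * s) ^ (q * 2)).trans hcon
    obtain ⟨x, hx0, hx⟩ : ∃ x : ℝ, 0 < x ∧ x ^ (q * 2) = I :=
      ⟨I ^ (((q * 2 : ℕ) : ℝ)⁻¹), by positivity,
        Real.rpow_inv_natCast_pow hI0 (by positivity)⟩
    have hxs : (2 * q - 1) * s < x := by
      rw [← hx] at hcon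
      exact lt_of_pow_lt_pow_left₀ _ hx0.le hcon
    have hdiff : ∫ t, ‖(a - star b) t‖ ^ (q * 2) ∂circleMeasure ≤ (x + x + s) ^ (q * 2) := by
      have h1 := integral_add_pow_le (f := fun t => ‖a t‖) (g := fun t => ‖a t‖)
        (by fun_prop) (by fun_prop) (fun t => norm_nonneg _) (fun t => norm_nonneg _) hx0 hx0
        hx.ge hx.ge
      have h2 := integral_add_pow_le (f := fun t => ‖a t‖ + ‖a t‖)
        (g := fun t => ‖(a + star b) t‖) (by fun_prop) (by fun_prop) (fun t => by positivity)
        (fun t => norm_nonneg _) (add_pos hx0 hx0) hs h1 h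
      refine le_trans (integral_circle_mono (by fun_prop) (by fun_prop) fun t => ?_) h2
      refine pow_le_pow_left₀ (norm_nonneg _) ?_ _
      have : (a - star b) t = a t + a t - (a + star b) t := by simp
      rw [this]
      exact (norm_sub_le _ _).trans (by gcongr; exact norm_add_le _ _)
    have hprod : ∫ t, ‖(a * a + star (-(b * b))) t‖ ^ q ∂circleMeasure ≤
        (s * (x + x + s)) ^ q := by
      have h1 := integral_mul_le_of_sq (f := fun t => ‖(a + star b) t‖ ^ q)
        (g := fun t => ‖(a - star b) t‖ ^ q) (by fun_prop) (by fun_prop)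
        (pow_pos hs q) (pow_pos (by positivity : 0 < x + x + s) q)
        (by simpa only [← pow_mul] using h) (by simpa only [← pow_mul] using hdiff)
      rw [mul_pow]
      refine le_of_eq_of_le (integral_congr_ae (Filter.Eventually.of_forall fun t => ?_)) h1
      simp only [← mul_pow, ← norm_mul]
      congr 2
      simp
      ring
    have hbb : circleMean (-(b * b)) = 0 := by
      rw [map_neg, circleMean_mul hb hb, hb0, mul_zero, neg_zero]
    have hfin := ih (mul_mem_discAlgebra ha ha)
      (Submodule.neg_mem _ (mul_mem_discAlgebra hb hb)) hbb
      (by positivity : 0 < s * (x + x + s)) hprod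
    have hsq : ∫ t, ‖(a * a) t‖ ^ q ∂circleMeasure = (x * x) ^ q := by
      rw [← pow_two x, ← pow_mul, mul_comm 2 q, hx, hI]
      refine integral_congr_ae (Filter.Eventually.of_forall fun t => ?_)
      simp only [ContinuousMap.mul_apply, norm_mul]
      rw [← pow_two, ← pow_mul, mul_comm 2 q]
    rw [hsq] at hfin
    have hle : x * x ≤ (q - 1) * (s * (x + x + s)) :=
      le_of_pow_le_pow_left₀ hq0 (mul_nonneg (by linarith) (by positivity)) hfin
    nlinarith [mul_pos hs hx0, mul_pos hs hs, mul_pos (sub_pos.2 hxs) hx0,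
      mul_pos (sub_pos.2 hxs) hs]

/-- An operator on the disc algebra which is contractive for the uniform norm and satisfies a
weighted `L¹` estimate with constant `exp p` is bounded for the weighted `L^(4p)` norm, with an
absolute constant: split the argument into two pieces by means of an analytic truncation. -/
lemma norm_apply_le_of_integral_pow_le {Y : Type*} [NormedAddCommGroup Y] [NormedSpace ℂ Y]
    {v : discAlgebra →L[ℂ] Y} (hv : ∀ a, ‖v a‖ ≤ ‖a‖) {φ : 𝕋 → ℝ} (hφ : Continuous φ)
    {p : ℕ} (hp : p ≠ 0)
    (hvφ : ∀ a : discAlgebra, ‖v a‖ ≤ exp p * ∫ t, ‖(a : C(𝕋, ℂ)) t‖ * φ t ∂circleMeasure)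
    {G : C(𝕋, ℂ)} (hG : G ∈ discAlgebra) (hGre : ∀ t, 0 < (G t).re)
    (hGφ : ∀ t, φ t ≤ ‖G t‖ ^ 2) (hGint : ∫ t, ‖G t‖ ^ 2 ∂circleMeasure ≤ 24)
    (a : discAlgebra)
    (ha : ∫ t, ‖(a : C(𝕋, ℂ)) t‖ ^ (4 * p) * ‖G t‖ ^ 2 ∂circleMeasure ≤ 1) :
    ‖v a‖ ≤ 33 * exp 1 := by
  obtain ⟨a, haA⟩ := a
  simp only at ha
  set τ := exp p with hτ
  have hτ0 : 0 < τ := exp_pos _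
  have hτp : exp 1 ^ p = τ := by rw [← exp_nat_mul, mul_one]
  set e := exp 1 with he
  have he0 : 0 < e := exp_pos _
  have hGn : ∀ t, 0 < ‖G t‖ := fun t => (hGre t).trans_le (Complex.re_le_norm _)
  have hGne : ∀ t, G t ≠ 0 := fun t => norm_pos_iff.1 (hGn t)
  set ρ : 𝕋 → ℝ := fun t => (‖a t‖ / e) ^ (2 * p) * ‖G t‖ with hρ
  have hρc : Continuous ρ := by fun_prop
  have hρ0 : ∀ t, 0 ≤ ρ t := fun t => by positivity
  obtain ⟨R, hR, hRρ, hRint⟩ := exists_mem_discAlgebra_re_approx hρc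
    (by positivity : 0 < (τ ^ 2)⁻¹)
  have hRre : ∀ t, 0 < (R t).re := fun t => (hρ0 t).trans_lt (hRρ t).1
  have hRne : ∀ t, R t ≠ 0 := fun t h => by simpa [h] using hRre t
  have hρint : ∫ t, ρ t ^ 2 ∂circleMeasure ≤ (τ ^ 4)⁻¹ := by
    have h : ∀ t, ρ t ^ 2 = (τ ^ 4)⁻¹ * (‖a t‖ ^ (4 * p) * ‖G t‖ ^ 2) := by
      intro t
      rw [hρ, ← hτp, ← pow_mul, mul_pow, ← pow_mul, div_pow]
      field_simp
      ring_nf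
    simp_rw [h]
    rw [integral_const_mul]
    exact mul_le_of_le_one_right (by positivity) ha
  have hRsq : ∫ t, ‖R t‖ ^ 2 ∂circleMeasure ≤ 8 * (τ ^ 4)⁻¹ := by
    have h : ∫ t, (R t).re ^ 2 ∂circleMeasure ≤
        ∫ t, (2 * ρ t ^ 2 + 2 * (τ ^ 4)⁻¹) ∂circleMeasure := by
      refine integral_circle_mono (by fun_prop) (by fun_prop) fun t => ?_
      calc (R t).re ^ 2 ≤ (ρ t + (τ ^ 2)⁻¹) ^ 2 :=
            pow_le_pow_left₀ (hRre t).le (hRρ t).2.le 2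
        _ ≤ 2 * ρ t ^ 2 + 2 * ((τ ^ 2)⁻¹) ^ 2 := by nlinarith [sq_nonneg (ρ t - (τ ^ 2)⁻¹)]
        _ = _ := by rw [← inv_pow, ← inv_pow, ← pow_mul]
    rw [integral_add (Continuous.integrable_circle (by fun_prop)) (integrable_const _),
      integral_const_mul, integral_const] at h
    simp only [probReal_univ, one_smul] at h
    linarith
  obtain ⟨LR, hLR, hLR'⟩ := exists_log_mem_discAlgebra hR hRre
  obtain ⟨LG, hLG, hLG'⟩ := exists_log_mem_discAlgebra hG hGre
  set M := expMap ((1 / 2 : ℂ) • (LR - LG)) with hM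
  have hMA : M ∈ discAlgebra :=
    expMap_mem_discAlgebra (Submodule.smul_mem _ _ (Submodule.sub_mem _ hLR hLG))
  have hMt : ∀ t, M t = Complex.exp ((1 / 2 : ℂ) * (Complex.log (R t) - Complex.log (G t))) := by
    intro t
    rw [hM, expMap_apply, ContinuousMap.smul_apply, ContinuousMap.sub_apply, hLR', hLG',
      smul_eq_mul]
  have hMsq : ∀ t, ‖M t‖ ^ 2 * ‖G t‖ = ‖R t‖ := by
    intro t
    have h : M t ^ 2 * G t = R t := by
      rw [hMt, ← Complex.exp_nat_mul]
      nth_rw 2 [← Complex.exp_log (hGne t)]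
      rw [← Complex.exp_add]
      nth_rw 2 [← Complex.exp_log (hRne t)]
      congr 1
      push_cast
      ring
    rw [← h, norm_mul, norm_pow]
  have hMre : ∀ t, 0 < (M t).re := by
    intro t
    have h1 := abs_lt.1 (Complex.abs_arg_lt_pi_div_two_iff.2 (Or.inl (hRre t)))
    have h2 := abs_lt.1 (Complex.abs_arg_lt_pi_div_two_iff.2 (Or.inl (hGre t)))
    rw [hMt, Complex.exp_re]
    refine mul_pos (exp_pos _) (cos_pos_of_mem_Ioo ?_)
    have h3 : ((1 / 2 : ℂ) * (Complex.log (R t) - Complex.log (G t))).im =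
        ((R t).arg - (G t).arg) / 2 := by
      rw [show (1 / 2 : ℂ) = ((1 / 2 : ℝ) : ℂ) by push_cast; rfl, Complex.im_ofReal_mul,
        Complex.sub_im, Complex.log_im, Complex.log_im]
      ring
    rw [h3]
    constructor <;> linarith [h1.1, h1.2, h2.1, h2.2]
  have hMa : ∀ t, (‖a t‖ / e) ^ p ≤ ‖M t‖ := by
    intro t
    have h : ((‖a t‖ / e) ^ p) ^ 2 * ‖G t‖ ≤ ‖M t‖ ^ 2 * ‖G t‖ := by
      rw [hMsq, ← pow_mul, mul_comm p 2]
      exact (hRρ t).1.le.trans (Complex.re_le_norm _)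
    exact le_of_pow_le_pow_left₀ two_ne_zero (norm_nonneg _) (le_of_mul_le_mul_right h (hGn t))
  have hre1 : ∀ t, 0 < ((1 + M) t).re := fun t => by
    simpa using add_pos one_pos (hMre t)
  have hne1 : ∀ t, (1 + M) t ≠ 0 := fun t h => by simpa [h] using hre1 t
  let D : C(𝕋, ℂ) := ⟨fun t => ((1 + M) t)⁻¹, (map_continuous (1 + M)).inv₀ hne1⟩
  have hDA : D ∈ discAlgebra :=
    inv_mem_discAlgebra (Submodule.add_mem _ one_mem_discAlgebra hMA) hre1 fun t => rfl
  have hD : ∀ t, ‖D t‖ = ‖(1 + M) t‖⁻¹ := fun t => norm_inv _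
  have hDM : ∀ t, D t * (1 + M t) = 1 := fun t => inv_mul_cancel₀ (hne1 t)
  have h1M : ∀ t, 1 ≤ ‖(1 + M) t‖ := fun t =>
    le_trans (by simpa using (hMre t).le) (Complex.re_le_norm _)
  have hMM : ∀ t, ‖M t‖ ≤ ‖(1 + M) t‖ := by
    intro t
    refine le_of_pow_le_pow_left₀ two_ne_zero (norm_nonneg _) ?_
    simp only [← Complex.normSq_eq_norm_sq, Complex.normSq_apply, ContinuousMap.add_apply,
      ContinuousMap.one_apply, Complex.add_re, Complex.add_im, Complex.one_re, Complex.one_im]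
    nlinarith [hMre t]
  have haM : ∀ t, ‖a t‖ ≤ e * ‖(1 + M) t‖ := by
    intro t
    rw [← div_le_iff₀' he0]
    rcases le_total (‖a t‖ / e) 1 with h | h
    · exact h.trans (h1M t)
    · exact (le_self_pow₀ h hp).trans ((hMa t).trans (hMM t))
  have haD : ∀ t, ‖(a * D) t‖ ≤ e := by
    intro t
    rw [ContinuousMap.mul_apply, norm_mul, hD, ← div_eq_mul_inv,
      div_le_iff₀ (one_pos.trans_le (h1M t))]
    exact haM t
  have hcR : ∀ t, ‖(a * D * M) t‖ * φ t ≤ e * τ⁻¹ * (τ ^ 4 * ‖R t‖ ^ 2 + ‖G t‖ ^ 2) := by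
    intro t
    have h1 : ‖(a * D * M) t‖ ≤ e * ‖M t‖ := by
      rw [ContinuousMap.mul_apply, norm_mul]
      exact mul_le_mul_of_nonneg_right (haD t) (norm_nonneg _)
    have h2 : ‖M t‖ ≤ τ⁻¹ * (τ ^ 4 * ‖M t‖ ^ 4 + 1) := by
      rw [inv_mul_eq_div, le_div_iff₀ hτ0, ← mul_pow, mul_comm]
      nlinarith [sq_nonneg ((τ * ‖M t‖) ^ 2 - 1 / 2), sq_nonneg (τ * ‖M t‖ - 1 / 2)]
    calc ‖(a * D * M) t‖ * φ t ≤ (e * ‖M t‖) * ‖G t‖ ^ 2 :=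
          mul_le_mul_of_nonneg h1 (hGφ t) (norm_nonneg _) (by positivity)
      _ ≤ (e * (τ⁻¹ * (τ ^ 4 * ‖M t‖ ^ 4 + 1))) * ‖G t‖ ^ 2 := by gcongr
      _ = _ := by rw [← hMsq]; ring
  have hsum : (⟨a, haA⟩ : discAlgebra) = ⟨a * D, mul_mem_discAlgebra haA hDA⟩ +
      ⟨a * D * M, mul_mem_discAlgebra (mul_mem_discAlgebra haA hDA) hMA⟩ := by
    ext t
    change a t = a t * D t + a t * D t * M t
    linear_combination (-a t) * hDM t
  have hb : ‖v ⟨a * D, mul_mem_discAlgebra haA hDA⟩‖ ≤ e :=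
    (hv _).trans ((ContinuousMap.norm_le _ he0.le).2 haD)
  have hc : ‖v ⟨a * D * M, mul_mem_discAlgebra (mul_mem_discAlgebra haA hDA) hMA⟩‖ ≤ 32 * e := by
    refine (hvφ _).trans ?_
    calc τ * ∫ t, ‖(a * D * M) t‖ * φ t ∂circleMeasure
        ≤ τ * ∫ t, e * τ⁻¹ * (τ ^ 4 * ‖R t‖ ^ 2 + ‖G t‖ ^ 2) ∂circleMeasure := by
          exact mul_le_mul_of_nonneg_left
            (integral_circle_mono (by fun_prop) (by fun_prop) hcR) hτ0.le
      _ = e * (τ ^ 4 * ∫ t, ‖R t‖ ^ 2 ∂circleMeasure + ∫ t, ‖G t‖ ^ 2 ∂circleMeasure) := by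
          rw [integral_const_mul, integral_add (Continuous.integrable_circle (by fun_prop))
            (Continuous.integrable_circle (by fun_prop)), integral_const_mul]
          field_simp
      _ ≤ e * (τ ^ 4 * (8 * (τ ^ 4)⁻¹) + 24) := by gcongr
      _ = 32 * e := by field_simp; ring
  rw [hsum, map_add]
  exact (norm_add_le _ _).trans (by linarith)

/-- The space of continuous functions on the circle whose Fourier coefficients vanish on the
nonnegative integers. -/
def coanalytic : Submodule ℂ C(𝕋, ℂ) where
  carrier := {f | star f ∈ discAlgebra ∧ circleMean (star f) = 0}
  zero_mem' := by simp
  add_mem' := by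
    rintro f g ⟨hf, hf0⟩ ⟨hg, hg0⟩
    exact ⟨by rw [star_add]; exact Submodule.add_mem _ hf hg, by
      rw [star_add, map_add, hf0, hg0, add_zero]⟩
  smul_mem' := by
    rintro c f ⟨hf, hf0⟩
    exact ⟨by rw [star_smul]; exact Submodule.smul_mem _ _ hf, by
      rw [star_smul, map_smul, hf0, smul_zero]⟩

/-- A contraction on the disc algebra satisfying a weighted `L¹` estimate with constant `n` extends
to `C(𝕋, ℂ)` with norm `O(log n)`. -/
lemma exists_extension_of_weighted_bound {Y : Type*} [NormedAddCommGroup Y] [NormedSpace ℂ Y]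
    [CompleteSpace Y] {v : discAlgebra →L[ℂ] Y} (hv : ∀ a, ‖v a‖ ≤ ‖a‖) {φ : 𝕋 → ℝ}
    (hφ : Continuous φ) (hφ1 : ∀ t, 1 ≤ φ t) (hφint : ∫ t, φ t ∂circleMeasure ≤ 3)
    {n : ℕ} (hn : 2 ≤ n)
    (hvφ : ∀ a : discAlgebra, ‖v a‖ ≤ n * ∫ t, ‖(a : C(𝕋, ℂ)) t‖ * φ t ∂circleMeasure) :
    ∃ w : C(𝕋, ℂ) →L[ℂ] Y, (∀ a : discAlgebra, w a = v a) ∧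
      ‖w‖ ≤ 6336 * exp 1 * log n := by
  have hlog2 : (1 / 2 : ℝ) < log 2 := by linarith [log_two_gt_d9]
  have hlogn : log 2 ≤ log n := log_le_log two_pos (by exact_mod_cast hn)
  obtain ⟨k, hk1, hk2⟩ := exists_nat_pow_near (x := 2 * log n) (y := 2) (by linarith) one_lt_two
  set p : ℕ := 2 ^ k with hp
  have hpr : (2 : ℝ) ^ k = p := by rw [hp]; push_cast; rfl
  rw [pow_succ, hpr] at hk2
  rw [hpr] at hk1
  have hp0 : p ≠ 0 := by positivity
  have hppos : (0 : ℝ) < p := by positivity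
  have hnp : (n : ℝ) ≤ exp p := by
    rw [← log_le_iff_le_exp (by positivity)]
    linarith
  have hqp : 2 ^ (k + 1 + 1) = 4 * p := by rw [hp]; ring
  have hqp' : (2 : ℝ) ^ (k + 1 + 1) = 4 * p := by rw [← hpr]; ring
  obtain ⟨G, hG, hGφ, hGint⟩ := exists_mem_discAlgebra_re_approx (ρ := fun t => √(φ t))
    (by fun_prop) one_pos
  have hsq : ∀ t, 1 ≤ √(φ t) := fun t => by rw [one_le_sqrt]; exact hφ1 t
  have hGre : ∀ t, 0 < (G t).re := fun t => by linarith [hsq t, (hGφ t).1]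
  have hGne : ∀ t, G t ≠ 0 := fun t h => by simpa [h] using hGre t
  have hφG : ∀ t, φ t ≤ ‖G t‖ ^ 2 := fun t => by
    rw [← sq_sqrt (zero_le_one.trans (hφ1 t))]
    exact pow_le_pow_left₀ (sqrt_nonneg _) ((hGφ t).1.le.trans (Complex.re_le_norm _)) 2
  have hG24 : ∫ t, ‖G t‖ ^ 2 ∂circleMeasure ≤ 24 := by
    have h : ∫ t, (G t).re ^ 2 ∂circleMeasure ≤ ∫ t, 4 * φ t ∂circleMeasure := by
      refine integral_circle_mono (by fun_prop) (by fun_prop) fun t => ?_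
      calc (G t).re ^ 2 ≤ (2 * √(φ t)) ^ 2 :=
            pow_le_pow_left₀ (hGre t).le (by linarith [hsq t, (hGφ t).2]) 2
        _ = 4 * φ t := by rw [mul_pow, sq_sqrt (zero_le_one.trans (hφ1 t))]; norm_num
    rw [integral_const_mul] at h
    linarith
  obtain ⟨L, hL, hLG⟩ := exists_log_mem_discAlgebra hG hGre
  set W := expMap ((2 / (4 * p : ℕ) : ℂ) • L) with hW
  set V := expMap (-((2 / (4 * p : ℕ) : ℂ) • L)) with hV
  have hWA : W ∈ discAlgebra := expMap_mem_discAlgebra (Submodule.smul_mem _ _ hL)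
  have hVA : V ∈ discAlgebra :=
    expMap_mem_discAlgebra (Submodule.neg_mem _ (Submodule.smul_mem _ _ hL))
  have hVW : V * W = 1 := by
    ext t
    rw [ContinuousMap.mul_apply, hV, hW, expMap_apply, expMap_apply, ← Complex.exp_add]
    simp
  have hVG : ∀ t, ‖V t‖ ^ (4 * p) * ‖G t‖ ^ 2 = 1 := by
    intro t
    have h : V t ^ (4 * p) * G t ^ 2 = 1 := by
      nth_rw 1 [← Complex.exp_log (hGne t)]
      rw [hV, expMap_apply, ← Complex.exp_nat_mul, ← Complex.exp_nat_mul, ← Complex.exp_add,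
        ContinuousMap.neg_apply, ContinuousMap.smul_apply, hLG, smul_eq_mul,
        ← Complex.exp_zero]
      congr 1
      have : (p : ℂ) ≠ 0 := by exact_mod_cast hp0
      push_cast
      field_simp
      ring
    rw [← norm_pow, ← norm_pow, ← norm_mul, h, norm_one]
  have hscaled : ∀ (a : discAlgebra) {s : ℝ}, 0 < s →
      ∫ t, ‖(a : C(𝕋, ℂ)) t‖ ^ (4 * p) * ‖G t‖ ^ 2 ∂circleMeasure ≤ s ^ (4 * p) →
      ‖v a‖ ≤ 33 * exp 1 * s := by
    intro a s hs h
    have hint0 : ∀ a : discAlgebra, 0 ≤ ∫ t, ‖(a : C(𝕋, ℂ)) t‖ * φ t ∂circleMeasure := fun a =>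
      integral_nonneg fun t => mul_nonneg (norm_nonneg _) (zero_le_one.trans (hφ1 t))
    have h1 := norm_apply_le_of_integral_pow_le hv hφ hp0
      (fun a => (hvφ a).trans (mul_le_mul_of_nonneg_right hnp (hint0 a))) hG hGre hφG hG24
      ((s⁻¹ : ℂ) • a) (by
        have : ∀ t, ‖(((s⁻¹ : ℂ) • a : discAlgebra) : C(𝕋, ℂ)) t‖ ^ (4 * p) * ‖G t‖ ^ 2 =
            (s ^ (4 * p))⁻¹ * (‖(a : C(𝕋, ℂ)) t‖ ^ (4 * p) * ‖G t‖ ^ 2) := by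
          intro t
          simp [mul_pow, abs_of_pos hs, mul_assoc]
        simp_rw [this]
        rw [integral_const_mul, inv_mul_le_iff₀ (by positivity), mul_one]
        exact h)
    rw [map_smul, norm_smul, norm_inv, Complex.norm_real, norm_eq_abs, abs_of_pos hs,
      inv_mul_le_iff₀ hs] at h1
    linarith
  let mulV : discAlgebra →ₗ[ℂ] discAlgebra :=
    (LinearMap.mulLeft ℂ V).restrict fun x hx => mul_mem_discAlgebra hVA hx
  let incl : discAlgebra × coanalytic →ₗ[ℂ] C(𝕋, ℂ) :=
    (LinearMap.mulLeft ℂ V).comp (discAlgebra.subtype.coprod coanalytic.subtype)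
  let op : discAlgebra × coanalytic →ₗ[ℂ] Y :=
    (v.toLinearMap.comp mulV).comp (LinearMap.fst ℂ discAlgebra coanalytic)
  have hdense : DenseRange incl := by
    have h1 : DenseRange (discAlgebra.subtype.coprod coanalytic.subtype) := by
      refine Metric.dense_iff.2 fun f ε hε => ?_
      obtain ⟨a, ha, b, hb, hb0, hab⟩ := exists_add_star_norm_sub_lt f hε
      refine ⟨a + star b, by rwa [Metric.mem_ball, dist_eq_norm],
        (⟨a, ha⟩, ⟨star b, ?_, ?_⟩), rfl⟩
      · rwa [star_star]
      · rwa [star_star]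
    have h2 : Function.Surjective (LinearMap.mulLeft ℂ V) := fun f =>
      ⟨W * f, by rw [LinearMap.mulLeft_apply, ← mul_assoc, hVW, one_mul]⟩
    exact h2.denseRange.comp h1 (continuous_const.mul continuous_id : Continuous fun f => V * f)
  have hbound : ∀ x, ‖op x‖ ≤ 6336 * exp 1 * log n * ‖incl x‖ := by
    rintro ⟨a, b, hbA, hb0⟩
    set f := incl (a, ⟨b, hbA, hb0⟩) with hf
    have hft : ∀ t, f t = V t * ((a : C(𝕋, ℂ)) + b) t := fun t => rfl
    have hkey : ∀ s, 24 * ‖f‖ < s → ‖op (a, ⟨b, hbA, hb0⟩)‖ ≤ 33 * exp 1 * (4 * p * s) := by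
      intro s hs
      have hs0 : 0 < s := lt_of_le_of_lt (by positivity) hs
      have h1 : ∫ t, ‖((a : C(𝕋, ℂ)) + star (star b)) t‖ ^ 2 ^ (k + 1 + 1) ∂circleMeasure ≤
          s ^ 2 ^ (k + 1 + 1) := by
        rw [star_star, hqp]
        have h : ∀ t, ‖((a : C(𝕋, ℂ)) + b) t‖ ^ (4 * p) ≤ ‖f‖ ^ (4 * p) * ‖G t‖ ^ 2 := by
          intro t
          calc ‖((a : C(𝕋, ℂ)) + b) t‖ ^ (4 * p)
              = ‖f t‖ ^ (4 * p) * ‖G t‖ ^ 2 := by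
                rw [hft, norm_mul, mul_pow]
                linear_combination (-‖((a : C(𝕋, ℂ)) + b) t‖ ^ (4 * p)) * hVG t
            _ ≤ _ := by gcongr; exact f.norm_coe_le_norm t
        calc ∫ t, ‖((a : C(𝕋, ℂ)) + b) t‖ ^ (4 * p) ∂circleMeasure
            ≤ ∫ t, ‖f‖ ^ (4 * p) * ‖G t‖ ^ 2 ∂circleMeasure :=
              integral_circle_mono (by fun_prop) (by fun_prop) h
          _ ≤ ‖f‖ ^ (4 * p) * 24 := by rw [integral_const_mul]; gcongr
          _ ≤ ‖f‖ ^ (4 * p) * 24 ^ (4 * p) := by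
              gcongr; exact le_self_pow₀ (by norm_num) (by positivity)
          _ = (24 * ‖f‖) ^ (4 * p) := by rw [mul_pow, mul_comm]
          _ ≤ s ^ (4 * p) := by gcongr
      have h2 := integral_norm_pow_le_of_add_star (k + 1) a.2 hbA hb0 hs0 h1
      rw [hqp, hqp'] at h2
      refine hscaled (mulV a) (by positivity) ?_
      have h3 : ∀ t, ‖(mulV a : C(𝕋, ℂ)) t‖ ^ (4 * p) * ‖G t‖ ^ 2 =
          ‖(a : C(𝕋, ℂ)) t‖ ^ (4 * p) := by
        intro t
        have : (mulV a : C(𝕋, ℂ)) t = V t * (a : C(𝕋, ℂ)) t := rfl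
        rw [this, norm_mul, mul_pow]
        linear_combination (‖(a : C(𝕋, ℂ)) t‖ ^ (4 * p)) * hVG t
      simp_rw [h3]
      refine h2.trans (pow_le_pow_left₀ (mul_nonneg ?_ hs0.le) (by gcongr; linarith) _)
      have : (1 : ℝ) ≤ p := by exact_mod_cast Nat.one_le_iff_ne_zero.2 hp0
      linarith
    have hlim : ‖op (a, ⟨b, hbA, hb0⟩)‖ / (33 * exp 1 * (4 * p)) ≤ 24 * ‖f‖ := by
      refine le_of_forall_gt_imp_ge_of_dense fun s hs => ?_
      rw [div_le_iff₀ (by positivity)]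
      linarith [hkey s hs]
    rw [div_le_iff₀ (by positivity)] at hlim
    calc ‖op (a, ⟨b, hbA, hb0⟩)‖ ≤ 24 * ‖f‖ * (33 * exp 1 * (4 * p)) := hlim
      _ ≤ 24 * ‖f‖ * (33 * exp 1 * (4 * (2 * log n))) := by gcongr
      _ = _ := by ring
  refine ⟨op.extendOfNorm incl, fun a => ?_,
    op.opNorm_extendOfNorm_le hdense (by positivity) hbound⟩
  have h := LinearMap.extendOfNorm_eq hdense ⟨_, hbound⟩ (⟨W * a, mul_mem_discAlgebra hWA a.2⟩, 0)
  have h1 : incl (⟨W * a, mul_mem_discAlgebra hWA a.2⟩, 0) = a := by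
    change V * (W * (a : C(𝕋, ℂ)) + 0) = a
    rw [add_zero, ← mul_assoc, hVW, one_mul]
  have h2 : mulV ⟨W * a, mul_mem_discAlgebra hWA a.2⟩ = a := by
    ext1
    change V * (W * (a : C(𝕋, ℂ))) = a
    rw [← mul_assoc, hVW, one_mul]
  rw [h1] at h
  rw [h]
  exact congrArg v h2

/-- **Auerbach's lemma**: a finite-dimensional space has a basis of vectors of norm at most `1`
whose coordinate functionals have norm at most `1`. -/
lemma exists_auerbach_basis (E : Type*) [NormedAddCommGroup E] [NormedSpace ℂ E]
    [FiniteDimensional ℂ E] :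
    ∃ b : Module.Basis (Fin (Module.finrank ℂ E)) ℂ E,
      (∀ i, ‖b i‖ ≤ 1) ∧ ∀ i x, ‖b.coord i x‖ ≤ ‖x‖ := by
  have : ProperSpace E := FiniteDimensional.proper ℂ E
  set e := Module.finBasis ℂ E
  have hcont : Continuous fun v : Fin (Module.finrank ℂ E) → E => ‖e.det v‖ := by
    have h : ∀ i, Continuous fun x : E => e.repr x i := fun i =>
      (e.coord i).continuous_of_finiteDimensional
    simp only [Module.Basis.det_apply]
    refine (Continuous.matrix_det (continuous_matrix fun i j => ?_)).norm
    exact (h i).comp (continuous_apply j)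
  have hK : IsCompact (Set.univ.pi fun _ : Fin (Module.finrank ℂ E) =>
      Metric.closedBall (0 : E) 1) := isCompact_univ_pi fun _ => isCompact_closedBall 0 1
  obtain ⟨v, hv, hmax⟩ := hK.exists_isMaxOn ⟨0, fun i _ => by simp⟩ hcont.continuousOn
  have hv1 : ∀ i, ‖v i‖ ≤ 1 := fun i => by simpa using hv i (Set.mem_univ i)
  have hle : ∀ w : Fin (Module.finrank ℂ E) → E, (∀ i, ‖w i‖ ≤ 1) → ‖e.det w‖ ≤ ‖e.det v‖ :=
    fun w hw => hmax fun i _ => by simpa using hw i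
  have hdet : e.det v ≠ 0 := by
    have h := hle (fun i => ((‖e i‖ : ℂ)⁻¹) • e i) fun i => by
      rw [norm_smul, norm_inv, Complex.norm_real, norm_norm,
        inv_mul_cancel₀ (norm_ne_zero_iff.2 (e.ne_zero i))]
    rw [AlternatingMap.map_smul_univ, e.det_self, norm_smul, norm_one, mul_one, norm_prod] at h
    refine norm_pos_iff.1 (lt_of_lt_of_le (Finset.prod_pos fun i _ => ?_) h)
    rw [norm_inv, Complex.norm_real, norm_norm]
    exact inv_pos.2 (norm_pos_iff.2 (e.ne_zero i))
  obtain ⟨hli, hsp⟩ := (Module.Basis.is_basis_iff_det e).2 (isUnit_iff_ne_zero.2 hdet)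
  refine ⟨Module.Basis.mk hli hsp.ge, fun i => by rw [Module.Basis.mk_apply]; exact hv1 i,
    fun i x => ?_⟩
  have hball : ∀ y : E, ‖y‖ ≤ 1 → ‖(Module.Basis.mk hli hsp.ge).coord i y‖ ≤ 1 := by
    intro y hy
    have h := LinearMap.congr_fun
      (Module.Basis.det_smul_mk_coord_eq_det_update (e := e) hli hsp.ge i) y
    have h1 : ‖e.det v‖ * ‖(Module.Basis.mk hli hsp.ge).coord i y‖ ≤ ‖e.det v‖ := by
      rw [← norm_mul]
      change ‖(e.det v • (Module.Basis.mk hli hsp.ge).coord i) y‖ ≤ _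
      rw [h]
      refine hle (Function.update v i y) fun j => ?_
      by_cases hj : j = i
      · subst hj; simpa using hy
      · simpa [Function.update_of_ne hj] using hv1 j
    exact le_of_mul_le_mul_left (by simpa using h1) (norm_pos_iff.2 hdet)
  rcases eq_or_ne x 0 with rfl | hx
  · rw [map_zero, norm_zero, norm_zero]
  · have hx0 := norm_pos_iff.2 hx
    have h := hball ((‖x‖ : ℂ)⁻¹ • x) (by
      rw [norm_smul, norm_inv, Complex.norm_real, norm_norm, inv_mul_cancel₀ hx0.ne'])
    rwa [map_smul, norm_smul, norm_inv, Complex.norm_real, norm_norm, inv_mul_le_iff₀ hx0,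
      mul_one] at h

/-- A functional of norm at most `1`, composed with a Fejér mean, is represented by a continuous
function of `L¹` norm at most `2`. -/
lemma exists_density_comp_fejerMean {Λ : C(𝕋, ℂ) →L[ℂ] ℂ} (hΛ : ∀ g, ‖Λ g‖ ≤ ‖g‖) (N : ℕ) :
    ∃ f : C(𝕋, ℂ), (∀ g, Λ (fejerMean N g) = circleMean (g * f)) ∧
      ∫ t, ‖f t‖ ∂circleMeasure ≤ 2 := by
  set f : C(𝕋, ℂ) := ((N : ℂ) + 1)⁻¹ • ∑ j ∈ Finset.range (N + 1), ∑ k ∈ Finset.range (N + 1),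
    Λ (fourier ((j : ℤ) - k)) • fourier (-((j : ℤ) - k)) with hf
  have hrep : ∀ g, Λ (fejerMean N g) = circleMean (g * f) := by
    intro g
    rw [fejerMean_apply, hf]
    simp only [map_smul, map_sum, mul_smul_comm, Finset.mul_sum]
    congr 1
    refine Finset.sum_congr rfl fun j _ => Finset.sum_congr rfl fun k _ => ?_
    rw [smul_eq_mul, smul_eq_mul, mul_comm g, mul_comm]
  refine ⟨f, hrep, ?_⟩
  have hpos : ∀ t, 0 < ‖f t‖ + 1 := fun t => by positivity
  have hne : ∀ t, ((‖f t‖ + 1 : ℝ) : ℂ) ≠ 0 := fun t =>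
    Complex.ofReal_ne_zero.2 (hpos t).ne'
  let g : C(𝕋, ℂ) := ⟨fun t => star (f t) / ((‖f t‖ + 1 : ℝ) : ℂ), by
    fun_prop (disch := exact hne _)⟩
  have hr : Continuous fun t => ‖f t‖ ^ 2 / (‖f t‖ + 1) := by
    exact Continuous.div (by fun_prop) (by fun_prop) fun t => (hpos t).ne'
  have hg : ‖g‖ ≤ 1 := by
    refine (ContinuousMap.norm_le _ zero_le_one).2 fun t => ?_
    change ‖star (f t) / ((‖f t‖ + 1 : ℝ) : ℂ)‖ ≤ 1
    rw [norm_div, norm_star, Complex.norm_real, norm_eq_abs, abs_of_pos (hpos t),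
      div_le_one (hpos t)]
    linarith
  have hgf : circleMean (g * f) =
      ((∫ t, ‖f t‖ ^ 2 / (‖f t‖ + 1) ∂circleMeasure : ℝ) : ℂ) := by
    rw [circleMean_apply, ← integral_complex_ofReal]
    congr 1
    ext t
    change star (f t) / ((‖f t‖ + 1 : ℝ) : ℂ) * f t = _
    rw [div_mul_eq_mul_div, mul_comm (star (f t)), RCLike.star_def, Complex.mul_conj,
      Complex.normSq_eq_norm_sq]
    push_cast
    rfl
  have hle : ∫ t, ‖f t‖ ^ 2 / (‖f t‖ + 1) ∂circleMeasure ≤ 1 := by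
    have h := (hΛ _).trans ((norm_fejerMean_le N g).trans hg)
    rw [hrep, hgf, Complex.norm_real] at h
    exact (le_abs_self _).trans h
  calc ∫ t, ‖f t‖ ∂circleMeasure
      ≤ ∫ t, (‖f t‖ ^ 2 / (‖f t‖ + 1) + 1) ∂circleMeasure := by
        refine integral_circle_mono (by fun_prop) (hr.add continuous_const) fun t => ?_
        rw [← sub_le_iff_le_add, le_div_iff₀ (hpos t)]
        linarith
    _ = ∫ t, ‖f t‖ ^ 2 / (‖f t‖ + 1) ∂circleMeasure + 1 := by
        rw [integral_add hr.integrable_circle (integrable_const _), integral_const]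
        simp
    _ ≤ 2 := by linarith

/-- The Fejér mean as an operator on the disc algebra. -/
def fejerMeanDisc (N : ℕ) : discAlgebra →L[ℂ] discAlgebra :=
  ((fejerMean N).restrict fun _ h => fejerMean_mem_discAlgebra h).mkContinuous 1 fun f => by
    rw [one_mul]; exact norm_fejerMean_le N f

lemma coe_fejerMeanDisc (N : ℕ) (f : discAlgebra) :
    (fejerMeanDisc N f : C(𝕋, ℂ)) = fejerMean N f := rfl

lemma exists_extension_comp_fejerMeanDisc {E : Type*} [NormedAddCommGroup E] [NormedSpace ℂ E]
    [FiniteDimensional ℂ E] {u : discAlgebra →L[ℂ] E} (hu : ∀ a, ‖u a‖ ≤ ‖a‖) {n : ℕ}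
    (hn : 2 ≤ n) (hE : Module.finrank ℂ E ≤ n) (N : ℕ) :
    ∃ w : C(𝕋, ℂ) →L[ℂ] E, (∀ a : discAlgebra, w a = u (fejerMeanDisc N a)) ∧
      ‖w‖ ≤ 6336 * exp 1 * log n := by
  have : CompleteSpace E := FiniteDimensional.complete ℂ E
  obtain ⟨b, hb, hcoord⟩ := exists_auerbach_basis E
  have hn0 : (0 : ℝ) < n := by positivity
  have hdens : ∀ i, ∃ f : C(𝕋, ℂ),
      (∀ a : discAlgebra, b.coord i (u (fejerMeanDisc N a)) = circleMean (a * f)) ∧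
      ∫ t, ‖f t‖ ∂circleMeasure ≤ 2 := by
    intro i
    obtain ⟨Λ, hΛ, hΛn⟩ := exists_extension_norm_eq discAlgebra
      (((b.coord i).comp u.toLinearMap).mkContinuous 1 fun a => by
        rw [one_mul]; exact (hcoord i _).trans (hu a))
    have hΛ1 : ‖Λ‖ ≤ 1 := hΛn.le.trans (LinearMap.mkContinuous_norm_le _ zero_le_one _)
    obtain ⟨f, hf, hf2⟩ := exists_density_comp_fejerMean
      (fun g => (Λ.le_of_opNorm_le hΛ1 g).trans_eq (one_mul _)) N
    exact ⟨f, fun a => by rw [← hf, ← coe_fejerMeanDisc, hΛ]; rfl, hf2⟩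
  choose f hf hf2 using hdens
  set φ : 𝕋 → ℝ := fun t => 1 + (n : ℝ)⁻¹ * ∑ i, ‖f i t‖ with hφ
  refine exists_extension_of_weighted_bound (v := u.comp (fejerMeanDisc N)) (φ := φ)
    (fun a => (hu _).trans (norm_fejerMean_le N a)) (by fun_prop)
    (fun t => le_add_of_nonneg_right (by positivity)) ?_ hn fun a => ?_
  · rw [integral_add (integrable_const _) (Continuous.integrable_circle (by fun_prop)),
      integral_const_mul, integral_finsetSum _ fun i _ =>
        Continuous.integrable_circle (by fun_prop), integral_const]
    have h : ∑ i, ∫ t, ‖f i t‖ ∂circleMeasure ≤ n * 2 := by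
      calc ∑ i, ∫ t, ‖f i t‖ ∂circleMeasure ≤ ∑ _i : Fin (Module.finrank ℂ E), (2 : ℝ) :=
            Finset.sum_le_sum fun i _ => hf2 i
        _ = Module.finrank ℂ E * 2 := by simp
        _ ≤ n * 2 := by gcongr
    have h2 : (n : ℝ)⁻¹ * ∑ i, ∫ t, ‖f i t‖ ∂circleMeasure ≤ 2 := by
      rw [inv_mul_le_iff₀ hn0]; exact h
    simp only [probReal_univ, one_smul]
    linarith
  · calc ‖u (fejerMeanDisc N a)‖ = ‖∑ i, b.coord i (u (fejerMeanDisc N a)) • b i‖ := by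
          conv_lhs => rw [← b.sum_repr (u (fejerMeanDisc N a))]
          rfl
      _ ≤ ∑ i, ∫ t, ‖(a : C(𝕋, ℂ)) t‖ * ‖f i t‖ ∂circleMeasure := by
          refine (norm_sum_le _ _).trans (Finset.sum_le_sum fun i _ => ?_)
          rw [norm_smul, hf]
          refine (mul_le_of_le_one_right (norm_nonneg _) (hb i)).trans
            ((norm_circleMean_le _).trans_eq ?_)
          simp only [ContinuousMap.mul_apply, norm_mul]
      _ = ∫ t, ∑ i, ‖(a : C(𝕋, ℂ)) t‖ * ‖f i t‖ ∂circleMeasure :=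
          (integral_finsetSum _ fun i _ => Continuous.integrable_circle (by fun_prop)).symm
      _ ≤ ∫ t, n * (‖(a : C(𝕋, ℂ)) t‖ * φ t) ∂circleMeasure := by
          refine integral_circle_mono (by fun_prop) (by fun_prop) fun t => ?_
          rw [← Finset.mul_sum, hφ]
          have h : (n : ℝ) * (‖(a : C(𝕋, ℂ)) t‖ * (1 + (n : ℝ)⁻¹ * ∑ i, ‖f i t‖)) =
              n * ‖(a : C(𝕋, ℂ)) t‖ + ‖(a : C(𝕋, ℂ)) t‖ * ∑ i, ‖f i t‖ := by
            field_simp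
          rw [h]
          exact le_add_of_nonneg_left (by positivity)
      _ = _ := integral_const_mul _ _

/-- A contraction of rank at most `n` on the disc algebra extends to `C(𝕋, ℂ)` with norm
`O(log n)`. -/
lemma exists_extension_of_contraction {E : Type*} [NormedAddCommGroup E] [NormedSpace ℂ E]
    [FiniteDimensional ℂ E] {u : discAlgebra →L[ℂ] E} (hu : ∀ a, ‖u a‖ ≤ ‖a‖) {n : ℕ}
    (hn : 2 ≤ n) (hE : Module.finrank ℂ E ≤ n) :
    ∃ w : C(𝕋, ℂ) →L[ℂ] E, (∀ a : discAlgebra, w a = u a) ∧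
      ‖w‖ ≤ 6336 * exp 1 * log n := by
  have : ProperSpace E := FiniteDimensional.proper ℂ E
  choose w hw hwn using exists_extension_comp_fejerMeanDisc hu hn hE
  set K := 6336 * exp 1 * log n with hK
  have hK0 : 0 ≤ K := by positivity
  have hlim : ∀ g, ∃ y ∈ Metric.closedBall (0 : E) (K * ‖g‖),
      Filter.Tendsto (fun N => w N g) (Filter.hyperfilter ℕ) (nhds y) := fun g =>
    (isCompact_closedBall (0 : E) (K * ‖g‖)).ultrafilter_le_nhds'
      ((Filter.hyperfilter ℕ).map fun N => w N g) (Ultrafilter.mem_map.2 (Filter.univ_mem'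
        fun N => mem_closedBall_zero_iff.2 ((w N).le_of_opNorm_le (hwn N) g)))
  choose l hl hlt using hlim
  let T : C(𝕋, ℂ) →ₗ[ℂ] E :=
    { toFun := l
      map_add' := fun f g => tendsto_nhds_unique (hlt (f + g)) (by
        simpa only [map_add] using (hlt f).add (hlt g))
      map_smul' := fun c f => tendsto_nhds_unique (hlt (c • f)) (by
        simpa only [map_smul, RingHom.id_apply] using (hlt f).const_smul c) }
  refine ⟨T.mkContinuous K fun g => mem_closedBall_zero_iff.1 (hl g), fun a => ?_,
    LinearMap.mkContinuous_norm_le _ hK0 _⟩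
  refine tendsto_nhds_unique (hlt a) ?_
  simp only [hw]
  refine (u.continuous.tendsto a).comp (Filter.Tendsto.mono_left ?_ Nat.hyperfilter_le_atTop)
  exact tendsto_subtype_rng.2 (tendsto_fejerMean a)

/-- **Final remark 1**: there is an absolute constant `C` such that every operator of rank at
most `n` (`n ≥ 2`) from the disc algebra into a Banach space `Y` extends to `C(𝕋, ℂ)` with
norm at most `C (log n) ‖u‖`. -/
theorem finite_rank_extension_log_bound :
    ∃ C : ℝ, 0 < C ∧
      ∀ (n : ℕ), 2 ≤ n →
        ∀ (Y : Type*) [NormedAddCommGroup Y] [NormedSpace ℂ Y] [CompleteSpace Y],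
          ∀ u : discAlgebra →L[ℂ] Y,
            FiniteDimensional ℂ (LinearMap.range u.toLinearMap) →
            Module.finrank ℂ (LinearMap.range u.toLinearMap) ≤ n →
            ∃ uhat : C(𝕋, ℂ) →L[ℂ] Y,
              (∀ f : discAlgebra, uhat (f : C(𝕋, ℂ)) = u f) ∧
              ‖uhat‖ ≤ C * Real.log n * ‖u‖ := by
  refine ⟨6336 * exp 1, by positivity, fun n hn Y _ _ _ u hfin hrank => ?_⟩
  rcases eq_or_ne u 0 with rfl | hu
  · exact ⟨0, by simp, by rw [ContinuousLinearMap.opNorm_zero]; positivity⟩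
  have hu0 : 0 < ‖u‖ := (u.opNorm_nonneg).lt_of_ne' fun h =>
    hu <| ContinuousLinearMap.ext fun x => norm_le_zero_iff.1 <|
      (u.le_opNorm x).trans_eq (by rw [h, zero_mul])
  have hu1 : (‖u‖ : ℂ) ≠ 0 := Complex.ofReal_ne_zero.2 hu0.ne'
  let v : discAlgebra →L[ℂ] LinearMap.range u.toLinearMap :=
    (‖u‖ : ℂ)⁻¹ • u.codRestrict _ fun a => LinearMap.mem_range_self u.toLinearMap a
  have hv : ∀ a, ‖v a‖ ≤ ‖a‖ := by
    intro a
    change ‖(‖u‖ : ℂ)⁻¹ • u a‖ ≤ ‖a‖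
    rw [norm_smul, norm_inv, Complex.norm_real, Real.norm_of_nonneg hu0.le, inv_mul_le_iff₀ hu0]
    exact u.le_opNorm a
  obtain ⟨w, hw, hwn⟩ := exists_extension_of_contraction hv hn hrank
  refine ⟨(‖u‖ : ℂ) • (LinearMap.range u.toLinearMap).subtypeL.comp w, fun a => ?_, ?_⟩
  · change (‖u‖ : ℂ) • (w a : Y) = u a
    rw [hw]
    change (‖u‖ : ℂ) • (‖u‖ : ℂ)⁻¹ • u a = u a
    rw [smul_inv_smul₀ hu1]
  · refine ContinuousLinearMap.opNorm_le_bound _ (by positivity) fun f => ?_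
    change ‖(‖u‖ : ℂ) • (w f : Y)‖ ≤ _
    rw [norm_smul, Complex.norm_real, Real.norm_of_nonneg hu0.le]
    exact (mul_le_mul_of_nonneg_left (w.le_of_opNorm_le hwn f) hu0.le).trans_eq (by ring)
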